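/- Let x ≥ e^{150}, set h = 11·x^{1/5}·log x, λ = 1.045, and H = 5.5·h, and assume H ≤ 5·x^{1/4}. Then |S(H, x^{2/5})| < 0.4372·h. -/

import Mathlib

/-- `Sset x h M N` is the set `S(M,N)` of odd integers `u` with `M < u ≤ N` such that
`1 − h/u² ≤ {x/u²} < 1`, where `{θ}` denotes the fractional part. -/
def Sset (x h M N : ℝ) : Set ℤ :=
  {u : ℤ | Odd u ∧ M < (u : ℝ) ∧ (u : ℝ) ≤ N ∧
    1 - h / (u : ℝ) ^ 2 ≤ Int.fract (x / (u : ℝ) ^ 2) ∧ Int.fract (x / (u : ℝ) ^ 2) < 1}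

theorem K_ident (n α x : ℝ) (hn : 0 < n) (hα : 0 < α) :
    (n + 3 * α) * (x / (n + 2 * α) ^ 2) - (n - α) * (x / n ^ 2)
      = 4 * α ^ 3 * x / (n * (n + 2 * α)) ^ 2 := by
  have h1 : n + 2 * α ≠ 0 := by positivity
  field_simp
  ring

theorem K_err (n α h M d1 d2 : ℝ) (hM : 0 < M) (hn : M < n) (hα : 0 < α) (hαn : α < n)
    (hh : 0 < h) (h1 : 0 < d1) (h1' : d1 ≤ h / n ^ 2) (h2 : 0 < d2)
    (h2' : d2 ≤ h / (n + 2 * α) ^ 2) :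
    |(n + 3 * α) * d2 - (n - α) * d1| ≤ h / M := by
  have hn0 : 0 < n := hM.trans hn
  have hhn : h / n ≤ h / M := by gcongr
  have e1 : (n + 3 * α) * d2 ≤ h / n := by
    calc (n + 3 * α) * d2 ≤ (n + 3 * α) * (h / (n + 2 * α) ^ 2) := by gcongr
      _ ≤ h / n := by
        rw [← mul_div_assoc, div_le_div_iff₀ (by positivity) hn0]
        nlinarith [mul_pos hn0 hα, mul_pos hh hα, mul_pos hh (mul_pos hn0 hα), mul_pos hh (mul_pos hα hα)]
  have e2 : (n - α) * d1 ≤ h / n := by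
    calc (n - α) * d1 ≤ n * (h / n ^ 2) := by
          apply mul_le_mul _ h1' h1.le hn0.le
          linarith
      _ = h / n := by field_simp
  have e3 : 0 < (n + 3 * α) * d2 := by positivity
  have e4 : 0 < (n - α) * d1 := mul_pos (by linarith) h1
  rw [abs_le]
  constructor <;> linarith

theorem XY_facts (n α β M : ℝ) (hM : 0 < M) (hn : M < n) (hα : 0 < α) (hβ : 0 < β)
    (hup : n + 2 * α + 2 * β ≤ 4096 / 3375 * M) :
    M ^ 2 ≤ n * (n + 2 * α + 2 * β) ∧ n * (n + 2 * α + 2 * β) ≤ (n + 2 * α) * (n + 2 * β) ∧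
    (n + 2 * α) * (n + 2 * β) ≤ (n + α + β) ^ 2 ∧
    (n + α + β) ^ 2 ≤ 1.0115 * (n * (n + 2 * α + 2 * β)) ∧
    (n + 2 * α) * (n + 2 * β) ≤ (4096 / 3375 * M) ^ 2 := by
  have h1 : M ^ 2 ≤ n * (n + 2 * α + 2 * β) := by nlinarith
  have hP : (α + β) ^ 2 ≤ 0.0115 * M ^ 2 := by
    have : α + β ≤ 721 / 6750 * M := by linarith
    have h0 : 0 < α + β := by positivity
    nlinarith
  refine ⟨h1, by nlinarith, by nlinarith [sq_nonneg (α - β)], by nlinarith, ?_⟩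
  have h2 : n + 2 * α ≤ 4096 / 3375 * M := by linarith
  have h3 : n + 2 * β ≤ 4096 / 3375 * M := by linarith
  rw [sq]
  apply mul_le_mul h2 h3 <;> nlinarith

theorem D_real (n α β x M : ℝ) (hx : 0 < x) (hM : 0 < M) (hn : M < n) (hα : 0 < α) (hβ : 0 < β)
    (hup : n + 2 * α + 2 * β ≤ 4096 / 3375 * M) :
    24 * (α * β) * x / (4096 / 3375 * M) ^ 4 ≤
      x / n ^ 2 - x / (n + 2 * α) ^ 2 - x / (n + 2 * β) ^ 2 + x / (n + 2 * α + 2 * β) ^ 2 ∧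
    x / n ^ 2 - x / (n + 2 * α) ^ 2 - x / (n + 2 * β) ^ 2 + x / (n + 2 * α + 2 * β) ^ 2 ≤
      24.4 * (α * β) * x / M ^ 4 := by
  obtain ⟨h1, h2, h3, h4, h5⟩ := XY_facts n α β M hM hn hα hβ hup
  have hn0 : 0 < n := hM.trans hn
  obtain ⟨X, hX⟩ : ∃ X, X = n * (n + 2 * α + 2 * β) := ⟨_, rfl⟩
  obtain ⟨Y, hY⟩ : ∃ Y, Y = (n + 2 * α) * (n + 2 * β) := ⟨_, rfl⟩
  obtain ⟨s, hs⟩ : ∃ s, s = n + α + β := ⟨_, rfl⟩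
  have hid : x / n ^ 2 - x / (n + 2 * α) ^ 2 - x / (n + 2 * β) ^ 2 + x / (n + 2 * α + 2 * β) ^ 2
      = 8 * (α * β) * x * ((2 * s ^ 2 * (X + Y) - X * Y) / (X * Y) ^ 2) := by
    rw [hX, hY, hs]
    have : n + 2 * α ≠ 0 := by positivity
    have : n + 2 * β ≠ 0 := by positivity
    have : n + 2 * α + 2 * β ≠ 0 := by positivity
    field_simp
    ring
  rw [← hX] at h1 h2 h4; rw [← hY] at h2 h3 h5; rw [← hs] at h3 h4
  have hX0 : 0 < X := by nlinarith
  have hY0 : 0 < Y := by linarith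
  have hc : 0 < 8 * (α * β) * x := by positivity
  have hXY : 0 < X * Y := by positivity
  rw [hid]
  constructor
  · have : 3 / (4096 / 3375 * M) ^ 4 ≤ (2 * s ^ 2 * (X + Y) - X * Y) / (X * Y) ^ 2 := by
      calc 3 / (4096 / 3375 * M) ^ 4 ≤ 3 / (X * Y) := by
            apply div_le_div_of_nonneg_left (by norm_num) hXY
            calc X * Y ≤ (4096 / 3375 * M) ^ 2 * (4096 / 3375 * M) ^ 2 := by gcongr; linarith
              _ = _ := by ring
        _ = 3 * (X * Y) / (X * Y) ^ 2 := by field_simp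
        _ ≤ _ := by
            gcongr
            nlinarith
    calc _ = 8 * (α * β) * x * (3 / (4096 / 3375 * M) ^ 4) := by ring
      _ ≤ _ := by gcongr
  · have : (2 * s ^ 2 * (X + Y) - X * Y) / (X * Y) ^ 2 ≤ 3.05 / M ^ 4 := by
      calc _ ≤ 3.05 * (X * Y) / (X * Y) ^ 2 := by
            gcongr
            have e1 : s ^ 2 * (X + Y) ≤ 1.0115 * X * (2 * Y) := by
              apply mul_le_mul h4 (by linarith) (by linarith) (by positivity)
            nlinarith
        _ = 3.05 / (X * Y) := by field_simp
        _ ≤ 3.05 / M ^ 4 := by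
            gcongr
            nlinarith [sq_nonneg M, pow_pos hM 2]
    calc _ ≤ 8 * (α * β) * x * (3.05 / M ^ 4) := by gcongr
      _ = _ := by ring

theorem E_real (n α β x M : ℝ) (hx : 0 < x) (hM : 0 < M) (hn : M < n) (hα : 0 < α) (hβ : α < β)
    (hup : n + 2 * α + 2 * β ≤ 4096 / 3375 * M) :
    32 * (α * β * (β ^ 2 - α ^ 2)) * x / ((4096 / 3375) ^ 6 * M ^ 5) ≤
      (β - α) * (x / n ^ 2 - x / (n + 2 * α + 2 * β) ^ 2)
        - (α + β) * (x / (n + 2 * α) ^ 2 - x / (n + 2 * β) ^ 2) ∧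
    (β - α) * (x / n ^ 2 - x / (n + 2 * α + 2 * β) ^ 2)
        - (α + β) * (x / (n + 2 * α) ^ 2 - x / (n + 2 * β) ^ 2) ≤
      32.4 * (α * β * (β ^ 2 - α ^ 2)) * x / M ^ 5 := by
  have hβ0 : 0 < β := hα.trans hβ
  obtain ⟨h1, h2, h3, h4, h5⟩ := XY_facts n α β M hM hn hα hβ0 hup
  have hn0 : 0 < n := hM.trans hn
  obtain ⟨X, hX⟩ : ∃ X, X = n * (n + 2 * α + 2 * β) := ⟨_, rfl⟩
  obtain ⟨Y, hY⟩ : ∃ Y, Y = (n + 2 * α) * (n + 2 * β) := ⟨_, rfl⟩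
  obtain ⟨s, hs⟩ : ∃ s, s = n + α + β := ⟨_, rfl⟩
  have hid : (β - α) * (x / n ^ 2 - x / (n + 2 * α + 2 * β) ^ 2)
        - (α + β) * (x / (n + 2 * α) ^ 2 - x / (n + 2 * β) ^ 2)
      = 16 * (α * β * (β ^ 2 - α ^ 2)) * x * (s * (X + Y) / (X * Y) ^ 2) := by
    rw [hX, hY, hs]
    have : n + 2 * α ≠ 0 := by positivity
    have : n + 2 * β ≠ 0 := by positivity
    have : n + 2 * α + 2 * β ≠ 0 := by positivity
    field_simp
    ring
  have hsM : M ≤ s := by rw [hs]; linarith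
  rw [← hX] at h1 h2 h4; rw [← hY] at h2 h3 h5; rw [← hs] at h3 h4
  have hX0 : 0 < X := by nlinarith
  have hY0 : 0 < Y := by linarith
  have hc : 0 < 16 * (α * β * (β ^ 2 - α ^ 2)) * x := by
    have : 0 < β ^ 2 - α ^ 2 := by nlinarith
    positivity
  have hXY : 0 < X * Y := by positivity
  rw [hid]
  constructor
  · have : 2 / ((4096 / 3375) ^ 6 * M ^ 5) ≤ s * (X + Y) / (X * Y) ^ 2 := by
      calc 2 / ((4096 / 3375) ^ 6 * M ^ 5) = 2 * M / ((4096 / 3375 * M) ^ 2 * ((4096 / 3375 * M) ^ 2) ^ 2) := by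
            field_simp
        _ ≤ 2 * M / (X * Y ^ 2) := by
            gcongr
            linarith
        _ = M * (2 * X) / (X * Y) ^ 2 := by field_simp
        _ ≤ _ := by
            gcongr <;> linarith
    calc _ = 16 * (α * β * (β ^ 2 - α ^ 2)) * x * (2 / ((4096 / 3375) ^ 6 * M ^ 5)) := by ring
      _ ≤ _ := by gcongr
  · have : s * (X + Y) / (X * Y) ^ 2 ≤ 2.023 / M ^ 5 := by
      calc _ ≤ (1.0115 * X / M) * (2 * Y) / (X * Y) ^ 2 := by
            have : s ≤ 1.0115 * X / M := by
              rw [le_div_iff₀ hM]; nlinarith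
            gcongr
            linarith
        _ = 2.023 / (M * (X * Y)) := by field_simp; norm_num
        _ ≤ 2.023 / (M * (M ^ 2 * M ^ 2)) := by
            gcongr
            linarith
        _ = _ := by ring
    calc _ ≤ 16 * (α * β * (β ^ 2 - α ^ 2)) * x * (2.023 / M ^ 5) := by gcongr
      _ ≤ 16 * (α * β * (β ^ 2 - α ^ 2)) * x * (2.025 / M ^ 5) := by gcongr; norm_num
      _ = _ := by ring

theorem count_bins (T : Finset ℤ) (a W Q : ℝ) (s : ℕ) (hQ : 0 < Q) (hW : 0 ≤ W)
    (hT : ∀ n ∈ T, a ≤ (n : ℝ) ∧ (n : ℝ) ≤ a + W)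
    (hU : ∀ U ⊆ T, U.card = s + 1 → ∃ n ∈ U, ∃ n' ∈ U, Q ≤ (n' : ℝ) - n) :
    (T.card : ℝ) ≤ s * (W / Q + 1) := by
  have key : T.card ≤ s * (Finset.Icc (0 : ℤ) ⌊W / Q⌋).card := by
    refine Finset.card_le_mul_card_image_of_maps_to (f := fun n : ℤ => ⌊((n : ℝ) - a) / Q⌋) ?_ s ?_
    · intro n hn
      obtain ⟨h1, h2⟩ := hT n hn
      simp only [Finset.mem_Icc]
      constructor
      · apply Int.floor_nonneg.mpr
        apply div_nonneg <;> linarith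
      · apply Int.floor_le_floor
        gcongr
        linarith
    · intro b hb
      by_contra hcon
      push Not at hcon
      obtain ⟨U, hU1, hU2⟩ := Finset.exists_subset_card_eq (Nat.succ_le_of_lt hcon)
      obtain ⟨n, hn, n', hn', hq⟩ := hU U (hU1.trans (Finset.filter_subset _ _)) hU2
      have e1 := (Finset.mem_filter.mp (hU1 hn)).2
      have e2 := (Finset.mem_filter.mp (hU1 hn')).2
      rw [Int.floor_eq_iff] at e1 e2
      have : ((n' : ℝ) - a) / Q - ((n : ℝ) - a) / Q < 1 := by linarith [e1.1, e2.2]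
      rw [← sub_div, div_lt_one hQ] at this
      linarith
  have h2 : ((Finset.Icc (0 : ℤ) ⌊W / Q⌋).card : ℝ) ≤ W / Q + 1 := by
    have h0 : 0 ≤ ⌊W / Q⌋ := Int.floor_nonneg.mpr (by positivity)
    rw [Int.card_Icc]
    have : (((⌊W / Q⌋ + 1 - 0).toNat : ℤ) : ℝ) = (⌊W / Q⌋ : ℝ) + 1 := by
      rw [Int.toNat_of_nonneg (by omega)]; push_cast; ring
    rw [← Int.cast_natCast, this]
    linarith [Int.floor_le (W / Q)]
  calc (T.card : ℝ) ≤ s * ((Finset.Icc (0 : ℤ) ⌊W / Q⌋).card : ℝ) := by exact_mod_cast key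
    _ ≤ _ := by gcongr

theorem span_of_sep (d : ℤ) (s : ℕ) : ∀ (U : Finset ℤ), U.card = s + 1 →
    (∀ n ∈ U, ∀ n' ∈ U, n < n' → n + d ≤ n') →
    ∃ n ∈ U, ∃ n' ∈ U, n + s * d ≤ n' ∧ n ≤ n' := by
  induction s with
  | zero =>
    intro U hU _
    obtain ⟨a, ha⟩ := Finset.card_pos.mp (by omega : 0 < U.card)
    exact ⟨a, ha, a, ha, by simp, le_rfl⟩
  | succ s ih =>
    intro U hU hsep
    have hne : U.Nonempty := Finset.card_pos.mp (by omega)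
    have hmax := U.max'_mem hne
    set b := U.max' hne with hb
    obtain ⟨n, hn, n', hn', hle, hle2⟩ := ih (U.erase b) (by rw [Finset.card_erase_of_mem hmax]; omega)
      (fun n hn n' hn' => hsep n (Finset.mem_of_mem_erase hn) n' (Finset.mem_of_mem_erase hn'))
    have h1 := Finset.mem_of_mem_erase hn'
    have h2 : n' < b := lt_of_le_of_ne (U.le_max' _ h1) (Finset.ne_of_mem_erase hn')
    have h3 := hsep n' h1 b hmax h2
    refine ⟨n, Finset.mem_of_mem_erase hn, b, hmax, ?_, by omega⟩
    push_cast
    linarith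

structure Ctx (x h M : ℝ) (A : Finset ℤ) (m : ℤ → ℤ) : Prop where
  hx : 0 < x
  hh : 0 < h
  hM : 100 ≤ M
  hhM : 11 * h ≤ 2 * M
  odd : ∀ u ∈ A, Odd u
  lo : ∀ u ∈ A, M < (u : ℝ)
  hi : ∀ u ∈ A, (u : ℝ) ≤ 4096 / 3375 * M
  m1 : ∀ u ∈ A, 0 < (m u : ℝ) - x / (u : ℝ) ^ 2
  m2 : ∀ u ∈ A, (m u : ℝ) - x / (u : ℝ) ^ 2 ≤ h / (u : ℝ) ^ 2

theorem Ctx.m3 {x h M : ℝ} {A : Finset ℤ} {m : ℤ → ℤ} (c : Ctx x h M A m) :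
    ∀ u ∈ A, (m u : ℝ) - x / (u : ℝ) ^ 2 ≤ h / M ^ 2 := by
  intro u hu
  have h1 := c.m2 u hu
  have h2 := c.lo u hu
  have h3 := c.hM
  have h4 := c.hh
  refine h1.trans ?_
  have : (0:ℝ) < M := by linarith
  gcongr

theorem hM2_small (h M : ℝ) (hM : 100 ≤ M) (hhM : 11 * h ≤ 2 * M) : h / M ^ 2 ≤ 2 / 11 / M := by
  have : 0 < M := by linarith
  rw [div_le_div_iff₀ (by positivity) this]
  nlinarith

theorem D_int {x h M : ℝ} {A : Finset ℤ} {m : ℤ → ℤ} (c : Ctx x h M A m) (n α β : ℤ)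
    (hα : 1 ≤ α) (hβ : 1 ≤ β) (p1 : n ∈ A) (p2 : n + 2 * α ∈ A) (p3 : n + 2 * β ∈ A)
    (p4 : n + 2 * α + 2 * β ∈ A) :
    (α : ℝ) * β ≤ (4096 / 3375) ^ 4 * h * M ^ 2 / (12 * x) ∨
      M ^ 4 / (24.5 * x) ≤ (α : ℝ) * β := by
  have hx := c.hx
  have hh := c.hh
  have hM0 := c.hM
  have hhM := c.hhM
  have hM : 0 < M := by linarith
  have hα' : (0:ℝ) < α := by exact_mod_cast hα
  have hβ' : (0:ℝ) < β := by exact_mod_cast hβ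
  have hup := c.hi _ p4
  push_cast at hup
  obtain ⟨D1, D2⟩ := D_real n α β x M hx hM (c.lo _ p1) hα' hβ' hup
  have a1 := c.m1 _ p1
  have a2 := c.m1 _ p2
  have a3 := c.m1 _ p3
  have a4 := c.m1 _ p4
  have b1 := c.m3 _ p1
  have b2 := c.m3 _ p2
  have b3 := c.m3 _ p3
  have b4 := c.m3 _ p4
  push_cast at a1 a2 a3 a4 b1 b2 b3 b4
  have small := hM2_small h M hM0 hhM
  have small2 : 2 / 11 / M ≤ 2 / 11 / 100 := by gcongr
  rcases le_or_gt (m n - m (n + 2 * α) - m (n + 2 * β) + m (n + 2 * α + 2 * β)) 0 with hD | hD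
  · left
    have hD' : (m n : ℝ) - m (n + 2 * α) - m (n + 2 * β) + m (n + 2 * α + 2 * β) ≤ 0 := by
      exact_mod_cast hD
    have : 24 * ((α : ℝ) * β) * x / (4096 / 3375 * M) ^ 4 ≤ 2 * (h / M ^ 2) := by linarith
    rw [← mul_div_assoc, div_le_div_iff₀ (by positivity) (by positivity)] at this
    rw [le_div_iff₀ (by positivity)]
    have h2 : 0 < M ^ 2 := by positivity
    by_contra hcon
    push Not at hcon
    have := mul_lt_mul_of_pos_right hcon h2
    linarith
  · right
    have hD' : (1 : ℝ) ≤ (m n : ℝ) - m (n + 2 * α) - m (n + 2 * β) + m (n + 2 * α + 2 * β) := by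
      exact_mod_cast hD
    have : 0.996 ≤ 24.4 * ((α : ℝ) * β) * x / M ^ 4 := by linarith
    rw [le_div_iff₀ (by positivity)] at this
    rw [div_le_iff₀ (by positivity)]
    have : 0 < M ^ 4 := by positivity
    linarith

set_option maxHeartbeats 2000000 in
theorem E_int {x h M : ℝ} {A : Finset ℤ} {m : ℤ → ℤ} (c : Ctx x h M A m) (n α β : ℤ)
    (hα : 1 ≤ α) (hβ : 2 * α ≤ β) (p1 : n ∈ A) (p2 : n + 2 * α ∈ A) (p3 : n + 2 * β ∈ A)
    (p4 : n + 2 * α + 2 * β ∈ A) (hD : M ^ 4 / (24.5 * x) ≤ (α : ℝ) * β) :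
    M ^ 5 / (34 * x) ≤ (α : ℝ) * β ^ 3 := by
  have hx := c.hx
  have hh := c.hh
  have hM0 := c.hM
  have hhM := c.hhM
  have hM : 0 < M := by linarith
  have hα' : (1:ℝ) ≤ α := by exact_mod_cast hα
  have hβ' : (2:ℝ) * α ≤ β := by exact_mod_cast hβ
  have hup := c.hi _ p4
  push_cast at hup
  have hlo := c.lo _ p1
  obtain ⟨D1, D2⟩ := E_real n α β x M hx hM hlo (by linarith) (by linarith) hup
  have a1 := c.m1 _ p1
  have a2 := c.m1 _ p2
  have a3 := c.m1 _ p3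
  have a4 := c.m1 _ p4
  have b1 := c.m3 _ p1
  have b2 := c.m3 _ p2
  have b3 := c.m3 _ p3
  have b4 := c.m3 _ p4
  push_cast at a1 a2 a3 a4 b1 b2 b3 b4
  have small := hM2_small h M hM0 hhM
  obtain ⟨d1, hd1⟩ : ∃ d, d = (m n : ℝ) - x / (n : ℝ) ^ 2 := ⟨_, rfl⟩
  obtain ⟨d2, hd2⟩ : ∃ d, d = (m (n + 2 * α) : ℝ) - x / ((n : ℝ) + 2 * α) ^ 2 := ⟨_, rfl⟩
  obtain ⟨d3, hd3⟩ : ∃ d, d = (m (n + 2 * β) : ℝ) - x / ((n : ℝ) + 2 * β) ^ 2 := ⟨_, rfl⟩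
  obtain ⟨d4, hd4⟩ : ∃ d, d = (m (n + 2 * α + 2 * β) : ℝ) - x / ((n : ℝ) + 2 * α + 2 * β) ^ 2 :=
    ⟨_, rfl⟩
  rw [← hd1] at a1 b1
  rw [← hd2] at a2 b2
  rw [← hd3] at a3 b3
  rw [← hd4] at a4 b4
  have hE : ((β : ℝ) - α) * (x / (n : ℝ) ^ 2 - x / ((n : ℝ) + 2 * α + 2 * β) ^ 2)
        - (α + β) * (x / ((n : ℝ) + 2 * α) ^ 2 - x / ((n : ℝ) + 2 * β) ^ 2)
      = ((β - α) * ((m n : ℝ) - m (n + 2 * α + 2 * β))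
        - (α + β) * ((m (n + 2 * α) : ℝ) - m (n + 2 * β)))
        - ((β - α) * (d1 - d4) - (α + β) * (d2 - d3)) := by
    rw [hd1, hd2, hd3, hd4]; ring
  have e1 : ((β : ℝ) - α) * (d1 - d4) ≤ (β - α) * (h / M ^ 2) := by
    apply mul_le_mul_of_nonneg_left <;> linarith
  have e2 : ((β : ℝ) - α) * (d4 - d1) ≤ (β - α) * (h / M ^ 2) := by
    apply mul_le_mul_of_nonneg_left <;> linarith
  have e3 : ((α : ℝ) + β) * (d2 - d3) ≤ (α + β) * (h / M ^ 2) := by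
    apply mul_le_mul_of_nonneg_left <;> linarith
  have e4 : ((α : ℝ) + β) * (d3 - d2) ≤ (α + β) * (h / M ^ 2) := by
    apply mul_le_mul_of_nonneg_left <;> linarith
  rw [hE] at D1 D2
  rcases le_or_gt ((β - α) * (m n - m (n + 2 * α + 2 * β)) - (α + β) * (m (n + 2 * α) - m (n + 2 * β))) 0
    with hD0 | hD0
  · exfalso
    have hD' : (β - α) * ((m n : ℝ) - m (n + 2 * α + 2 * β))
        - (α + β) * ((m (n + 2 * α) : ℝ) - m (n + 2 * β)) ≤ 0 := by
      exact_mod_cast hD0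
    have h1 : 32 * ((α : ℝ) * β * (β ^ 2 - α ^ 2)) * x / ((4096 / 3375) ^ 6 * M ^ 5)
        ≤ 2 * β * (2 / 11 / M) := by
      have : 2 * (β : ℝ) * (h / M ^ 2) ≤ 2 * β * (2 / 11 / M) := by
        apply mul_le_mul_of_nonneg_left small; linarith
      linarith
    have h1' : 2 * (β : ℝ) * (2 / 11 / M) = 4 / 11 * β / M := by ring
    rw [h1', div_le_div_iff₀ (by positivity) hM] at h1
    rw [div_le_iff₀ (by positivity)] at hD
    have h3 : 0.75 * (β : ℝ) ^ 2 ≤ β ^ 2 - α ^ 2 := by nlinarith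
    have hβ0 : (2 : ℝ) ≤ β := by linarith
    have h4 : 32 * ((α : ℝ) * β * (0.75 * β ^ 2)) * x * M ≤
        4 / 11 * β * ((4096 / 3375) ^ 6 * M ^ 5) := by
      refine le_trans ?_ h1
      gcongr
    have h5 : 24 * β * (α * β * x) ≤ 4 / 11 * ((4096 / 3375 : ℝ) ^ 6 * M ^ 4) := by
      have : 0 < (β : ℝ) * M := by positivity
      refine le_of_mul_le_mul_right ?_ this
      linarith
    have h6 : 24 * 2 * (α * β * x) ≤ 4 / 11 * ((4096 / 3375 : ℝ) ^ 6 * M ^ 4) := by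
      refine le_trans ?_ h5
      gcongr
    have : 0 < M ^ 4 := by positivity
    norm_num at h6 hD
    linarith
  · have hD' : 1 ≤ (β - α) * ((m n : ℝ) - m (n + 2 * α + 2 * β))
        - (α + β) * ((m (n + 2 * α) : ℝ) - m (n + 2 * β)) := by
      exact_mod_cast hD0
    have h1 : 1 - 2 * β * (2 / 11 / M) ≤
        32.4 * ((α : ℝ) * β * (β ^ 2 - α ^ 2)) * x / M ^ 5 := by
      have : 2 * (β : ℝ) * (h / M ^ 2) ≤ 2 * β * (2 / 11 / M) := by
        apply mul_le_mul_of_nonneg_left small; linarith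
      linarith
    have h2 : 2 * (β : ℝ) * (2 / 11 / M) ≤ 0.0389 := by
      have : 2 * (β : ℝ) * (2 / 11 / M) = (4 / 11 * β) / M := by ring
      rw [this, div_le_iff₀ hM]
      linarith
    have h3 : 0.9611 ≤ 32.4 * ((α : ℝ) * β * (β ^ 2)) * x / M ^ 5 := by
      have : 32.4 * ((α : ℝ) * β * (β ^ 2 - α ^ 2)) * x / M ^ 5
        ≤ 32.4 * ((α : ℝ) * β * (β ^ 2)) * x / M ^ 5 := by
        have hβ0 : (0 : ℝ) < β := by linarith
        gcongr
        nlinarith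
      linarith
    rw [le_div_iff₀ (by positivity)] at h3
    rw [div_le_iff₀ (by positivity)]
    have : 0 < M ^ 5 := by positivity
    linarith

/-- The K-integer. -/
def Kint (m : ℤ → ℤ) (α n : ℤ) : ℤ := (n + 3 * α) * m (n + 2 * α) - (n - α) * m n

theorem K_int {x h M : ℝ} {A : Finset ℤ} {m : ℤ → ℤ} (c : Ctx x h M A m) (n α : ℤ)
    (hα : 1 ≤ α) (p1 : n ∈ A) (p2 : n + 2 * α ∈ A) :
    |(Kint m α n : ℝ) - 4 * (α : ℝ) ^ 3 * x / ((n : ℝ) * (n + 2 * α)) ^ 2| ≤ h / M := by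
  have hM0 := c.hM
  have hM : 0 < M := by linarith
  have hα' : (1:ℝ) ≤ α := by exact_mod_cast hα
  have lo := c.lo _ p1
  have hi := c.hi _ p2
  have a1 := c.m1 _ p1
  have a2 := c.m1 _ p2
  have b1 := c.m2 _ p1
  have b2 := c.m2 _ p2
  push_cast at hi a1 a2 b1 b2
  have := K_err n α h M _ _ hM lo (by linarith) (by linarith) c.hh a1 b1 a2 b2
  rw [← K_ident n α x (by linarith) (by linarith)]
  unfold Kint
  push_cast
  convert this using 2
  ring

theorem K_case {x h M : ℝ} {A : Finset ℤ} {m : ℤ → ℤ} (c : Ctx x h M A m) (n α : ℤ)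
    (hα : 1 ≤ α) (p1 : n ∈ A) (p2 : n + 2 * α ∈ A)
    (hbig : (4096 / 3375) ^ 4 * h * M ^ 3 / (4 * x) < (α : ℝ) ^ 3) :
    1 ≤ Kint m α n ∧ (Kint m α n : ℝ) ≤ 11 / 9 * (4 * (α : ℝ) ^ 3 * x / M ^ 4) := by
  have hx := c.hx
  have hM0 := c.hM
  have hM : 0 < M := by linarith
  have hα' : (1:ℝ) ≤ α := by exact_mod_cast hα
  have lo := c.lo _ p1
  have lo2 := c.lo _ p2
  have hi := c.hi _ p1
  have hi2 := c.hi _ p2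
  push_cast at hi2 lo2
  have hK := abs_le.mp (K_int c n α hα p1 p2)
  have hn0 : (0:ℝ) < n := by linarith
  have hhM : h / M ≤ 2 / 11 := by
    rw [div_le_div_iff₀ hM (by norm_num)]; linarith [c.hhM]
  have g1 : 4 * (α : ℝ) ^ 3 * x / ((n : ℝ) * (n + 2 * α)) ^ 2 ≤ 4 * (α : ℝ) ^ 3 * x / M ^ 4 := by
    have : M ^ 4 = (M * M) ^ 2 := by ring
    rw [this]
    gcongr
  have g2 : 4 * (α : ℝ) ^ 3 * x / (4096 / 3375 * M) ^ 4 ≤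
      4 * (α : ℝ) ^ 3 * x / ((n : ℝ) * (n + 2 * α)) ^ 2 := by
    have : (4096 / 3375 * M) ^ 4 = ((4096 / 3375 * M) * (4096 / 3375 * M)) ^ 2 := by ring
    rw [this]
    gcongr
  have g3 : h / M < 4 * (α : ℝ) ^ 3 * x / (4096 / 3375 * M) ^ 4 := by
    rw [div_lt_iff₀ (by positivity)] at hbig
    rw [div_lt_div_iff₀ hM (by positivity)]
    have := mul_lt_mul_of_pos_right hbig hM
    linarith
  have k1 : 1 ≤ Kint m α n := by
    have : (0 : ℝ) < Kint m α n := by linarith [hK.1]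
    exact_mod_cast this
  have k1' : (1 : ℝ) ≤ Kint m α n := by exact_mod_cast k1
  refine ⟨k1, ?_⟩
  linarith [hK.2]

theorem K_window {x h M : ℝ} {A : Finset ℤ} {m : ℤ → ℤ} (c : Ctx x h M A m) (n n' α : ℤ)
    (hα : 1 ≤ α) (p1 : n ∈ A) (p2 : n + 2 * α ∈ A) (q1 : n' ∈ A) (q2 : n' + 2 * α ∈ A)
    (hnn : n ≤ n') (hk : Kint m α n = Kint m α n') :
    (n' : ℝ) - n ≤ (4096 / 3375) ^ 6 * h * M ^ 4 / (8 * (α : ℝ) ^ 3 * x) := by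
  have hx := c.hx
  have hM0 := c.hM
  have hM : 0 < M := by linarith
  have hα' : (1:ℝ) ≤ α := by exact_mod_cast hα
  have hnn' : (n:ℝ) ≤ n' := by exact_mod_cast hnn
  have lo := c.lo _ p1
  have lo' := c.lo _ q1
  have hi := c.hi _ q1
  have hi2 := c.hi _ q2
  push_cast at hi2
  have hK := abs_le.mp (K_int c n α hα p1 p2)
  have hK' := abs_le.mp (K_int c n' α hα q1 q2)
  rw [hk] at hK
  obtain ⟨P, hP⟩ : ∃ P, P = (n : ℝ) * (n + 2 * α) := ⟨_, rfl⟩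
  obtain ⟨P', hP'⟩ : ∃ P, P = (n' : ℝ) * (n' + 2 * α) := ⟨_, rfl⟩
  rw [← hP] at hK
  rw [← hP'] at hK'
  have hn0 : (0:ℝ) < n := by linarith
  have hP0 : 0 < P := by rw [hP]; positivity
  have hPP : 2 * M * ((n' : ℝ) - n) ≤ P' - P := by
    rw [hP, hP']; nlinarith
  have hPle : P ≤ P' := by nlinarith
  have hP'0 : 0 < P' := by linarith
  have hP'le : P' ≤ (4096 / 3375 * M) ^ 2 := by
    rw [hP', sq]
    gcongr
    linarith
  have g0 : 4 * (α : ℝ) ^ 3 * x / P ^ 2 - 4 * (α : ℝ) ^ 3 * x / P' ^ 2 ≤ 2 * (h / M) := by linarith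
  have g1 : 2 * (P' - P) / P' ^ 3 ≤ 1 / P ^ 2 - 1 / P' ^ 2 := by
    have : 1 / P ^ 2 - 1 / P' ^ 2 = (P' - P) * (P' * (P' + P)) / (P ^ 2 * P' ^ 3) := by
      field_simp; ring
    rw [this, div_le_div_iff₀ (by positivity) (by positivity)]
    have h1 : 2 * P ^ 2 ≤ P' * (P' + P) := by nlinarith
    have h2 : 0 ≤ (P' - P) * P' ^ 3 := mul_nonneg (by linarith) (by positivity)
    nlinarith
  have g2 : 2 * (2 * M * ((n' : ℝ) - n)) / ((4096 / 3375 * M) ^ 2) ^ 3 ≤ 2 * (P' - P) / P' ^ 3 := by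
    have : 0 ≤ P' - P := by linarith
    gcongr
  have g3 : 4 * (α : ℝ) ^ 3 * x * (2 * (2 * M * ((n' : ℝ) - n)) / ((4096 / 3375 * M) ^ 2) ^ 3)
      ≤ 2 * (h / M) := by
    refine le_trans ?_ g0
    have : 4 * (α : ℝ) ^ 3 * x / P ^ 2 - 4 * (α : ℝ) ^ 3 * x / P' ^ 2 =
      4 * (α : ℝ) ^ 3 * x * (1 / P ^ 2 - 1 / P' ^ 2) := by ring
    rw [this]
    gcongr
    exact g2.trans g1
  rw [← mul_div_assoc, ← mul_div_assoc, div_le_div_iff₀ (by positivity) hM] at g3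
  rw [le_div_iff₀ (by positivity)]
  have : 0 < M ^ 2 := by positivity
  refine le_of_mul_le_mul_right ?_ this
  linarith

def Tset (A : Finset ℤ) (α : ℤ) : Finset ℤ :=
  A.filter (fun n => n + 2 * α ∈ A ∧ ∀ y ∈ A, n < y → n + 2 * α ≤ y)

theorem mem_Tset {A : Finset ℤ} {α n : ℤ} : n ∈ Tset A α ↔
    n ∈ A ∧ n + 2 * α ∈ A ∧ ∀ y ∈ A, n < y → n + 2 * α ≤ y := by
  simp [Tset]

theorem T_span {x h M : ℝ} {A : Finset ℤ} {m : ℤ → ℤ} (c : Ctx x h M A m) (α : ℤ)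
    (s : ℕ) (U : Finset ℤ) (hU : U ⊆ Tset A α) (hc : U.card = s + 1) :
    ∃ n ∈ U, ∃ n' ∈ U, ∃ β : ℤ, n' = n + 2 * β ∧ s * α ≤ β := by
  obtain ⟨n, hn, n', hn', h1, h2⟩ := span_of_sep (2 * α) s U hc (by
    intro n hn n' hn' hlt
    exact (mem_Tset.mp (hU hn)).2.2 n' (mem_Tset.mp (hU hn')).1 hlt)
  obtain ⟨a, ha⟩ := c.odd _ (mem_Tset.mp (hU hn)).1
  obtain ⟨b, hb⟩ := c.odd _ (mem_Tset.mp (hU hn')).1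
  refine ⟨n, hn, n', hn', b - a, by omega, ?_⟩
  have : (s : ℤ) * (2 * α) = 2 * (s * α) := by ring
  omega

theorem T_D {x h M : ℝ} {A : Finset ℤ} {m : ℤ → ℤ} (c : Ctx x h M A m) (α : ℤ) (hα : 1 ≤ α)
    (s : ℕ) (hs : 1 ≤ s) (hC : (4096 / 3375) ^ 4 * h * M ^ 2 / (12 * x) < s * (α : ℝ) ^ 2)
    (U : Finset ℤ) (hU : U ⊆ Tset A α) (hc : U.card = s + 1) :
    ∃ n ∈ U, ∃ n' ∈ U, ∃ β : ℤ, n' = n + 2 * β ∧ s * α ≤ β ∧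
      M ^ 4 / (24.5 * x) ≤ (α : ℝ) * β := by
  obtain ⟨n, hn, n', hn', β, h1, h2⟩ := T_span c α s U hU hc
  refine ⟨n, hn, n', hn', β, h1, h2, ?_⟩
  have t1 := mem_Tset.mp (hU hn)
  have t2 := mem_Tset.mp (hU hn')
  have hs' : (1:ℤ) ≤ s := by exact_mod_cast hs
  have hβ : 1 ≤ β := by nlinarith
  have e : n' + 2 * α = n + 2 * α + 2 * β := by omega
  rcases D_int c n α β hα hβ t1.1 t1.2.1 (h1 ▸ t2.1) (e ▸ t2.2.1) with hD | hD
  · exfalso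
    have h2' : (s : ℝ) * α ≤ β := by exact_mod_cast h2
    have hα' : (1:ℝ) ≤ α := by exact_mod_cast hα
    nlinarith
  · exact hD

theorem T_E {x h M : ℝ} {A : Finset ℤ} {m : ℤ → ℤ} (c : Ctx x h M A m) (α : ℤ) (hα : 1 ≤ α)
    (hC : (4096 / 3375) ^ 4 * h * M ^ 2 / (12 * x) < 2 * (α : ℝ) ^ 2)
    (G : ℝ) (hG : 34 * α * G ^ 3 * x ≤ M ^ 5)
    (U : Finset ℤ) (hU : U ⊆ Tset A α) (hc : U.card = 2 + 1) :
    ∃ n ∈ U, ∃ n' ∈ U, 2 * G ≤ (n' : ℝ) - n := by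
  obtain ⟨n, hn, n', hn', β, h1, h2, h3⟩ := T_D c α hα 2 (by norm_num) (by exact_mod_cast hC) U hU hc
  refine ⟨n, hn, n', hn', ?_⟩
  have t1 := mem_Tset.mp (hU hn)
  have t2 := mem_Tset.mp (hU hn')
  have e : n' + 2 * α = n + 2 * α + 2 * β := by omega
  have hE := E_int c n α β hα (by exact_mod_cast h2) t1.1 t1.2.1 (h1 ▸ t2.1) (e ▸ t2.2.1) h3
  have hx := c.hx
  have hα' : (0:ℝ) < α := by exact_mod_cast hα
  have hβ' : (0:ℝ) ≤ β := by
    have : (0:ℤ) ≤ β := by push_cast at h2; omega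
    exact_mod_cast this
  rw [div_le_iff₀ (by positivity)] at hE
  have : G ^ 3 ≤ (β : ℝ) ^ 3 := by
    have h0 : 0 < 34 * (α : ℝ) * x := by positivity
    refine le_of_mul_le_mul_right ?_ h0
    linarith
  have hGβ : G ≤ β := le_of_pow_le_pow_left₀ (by norm_num) hβ' this
  rw [h1]; push_cast; linarith

theorem tB1 {x h M : ℝ} {A : Finset ℤ} {m : ℤ → ℤ} (c : Ctx x h M A m) (α : ℤ) (hα : 1 ≤ α)
    (hC : (4096 / 3375) ^ 4 * h * M ^ 2 / (12 * x) < 2 * (α : ℝ) ^ 2)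
    (G : ℝ) (hG0 : 0 < G) (hG : 34 * α * G ^ 3 * x ≤ M ^ 5) :
    ((Tset A α).card : ℝ) ≤ 2 * (721 / 3375 * M / (2 * G) + 1) := by
  have hM := c.hM
  have := count_bins (Tset A α) M (721 / 3375 * M) (2 * G) 2 (by positivity) (by linarith)
    (by
      intro n hn
      have t := (mem_Tset.mp hn).1
      have := c.lo _ t
      have := c.hi _ t
      constructor <;> linarith) (T_E c α hα hC G hG)
  exact_mod_cast this

theorem tB2 {x h M : ℝ} {A : Finset ℤ} {m : ℤ → ℤ} (c : Ctx x h M A m) (α : ℤ) (hα : 1 ≤ α)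
    (s : ℕ) (hs : 1 ≤ s) (hC : (4096 / 3375) ^ 4 * h * M ^ 2 / (12 * x) < s) :
    ((Tset A α).card : ℝ) ≤ s * (721 / 3375 * M / (2 * (M ^ 4 / (24.5 * x) / α)) + 1) := by
  have hM := c.hM
  have hx := c.hx
  have hM0 : 0 < M := by linarith
  have hα' : (1:ℝ) ≤ α := by exact_mod_cast hα
  have hs' : (1:ℝ) ≤ s := by exact_mod_cast hs
  refine count_bins (Tset A α) M (721 / 3375 * M) _ s (by positivity) (by linarith)
    (by
      intro n hn
      have t := (mem_Tset.mp hn).1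
      have := c.lo _ t
      have := c.hi _ t
      constructor <;> linarith) ?_
  intro U hU hc
  obtain ⟨n, hn, n', hn', β, h1, h2, h3⟩ := T_D c α hα s hs
    (hC.trans_le (le_mul_of_one_le_right (by linarith) (one_le_pow₀ hα'))) U hU hc
  refine ⟨n, hn, n', hn', ?_⟩
  have : M ^ 4 / (24.5 * x) / α ≤ β := by
    rw [div_le_iff₀ (by positivity)]; linarith
  rw [h1]; push_cast; linarith

theorem tA {x h M : ℝ} {A : Finset ℤ} {m : ℤ → ℤ} (c : Ctx x h M A m) (α : ℤ) (hα : 1 ≤ α)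
    (hbig : (4096 / 3375) ^ 4 * h * M ^ 3 / (4 * x) < (α : ℝ) ^ 3)
    (hC : (4096 / 3375) ^ 4 * h * M ^ 2 / (12 * x) < 2 * (α : ℝ) ^ 2)
    (G : ℝ) (hG0 : 0 < G) (hG : 34 * α * G ^ 3 * x ≤ M ^ 5) :
    ((Tset A α).card : ℝ) ≤ 2 * ((4096 / 3375) ^ 6 * h * M ^ 4 / (8 * (α : ℝ) ^ 3 * x) / (2 * G) + 1)
      * (11 / 9 * (4 * (α : ℝ) ^ 3 * x / M ^ 4)) := by
  have hM := c.hM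
  have hx := c.hx
  have hh := c.hh
  have hM0 : 0 < M := by linarith
  have hα' : (1:ℝ) ≤ α := by exact_mod_cast hα
  obtain ⟨K, hK⟩ : ∃ K, K = 11 / 9 * (4 * (α : ℝ) ^ 3 * x / M ^ 4) := ⟨_, rfl⟩
  obtain ⟨W, hW⟩ : ∃ W, W = (4096 / 3375) ^ 6 * h * M ^ 4 / (8 * (α : ℝ) ^ 3 * x) := ⟨_, rfl⟩
  have hK0 : 0 ≤ K := by rw [hK]; positivity
  have hW0 : 0 ≤ W := by rw [hW]; positivity
  rw [← hK, ← hW]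
  have key : (Tset A α).card = ∑ k ∈ Finset.Icc 1 ⌊K⌋, ((Tset A α).filter (fun n => Kint m α n = k)).card := by
    apply Finset.card_eq_sum_card_fiberwise
    intro n hn
    have t := mem_Tset.mp (Finset.mem_coe.mp hn)
    obtain ⟨k1, k2⟩ := K_case c n α hα t.1 t.2.1 hbig
    simp only [Finset.coe_Icc, Set.mem_Icc]
    exact ⟨k1, Int.le_floor.mpr (hK ▸ k2)⟩
  have each : ∀ k ∈ Finset.Icc 1 ⌊K⌋, (((Tset A α).filter (fun n => Kint m α n = k)).card : ℝ)
      ≤ 2 * (W / (2 * G) + 1) := by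
    intro k hk
    obtain ⟨V, hV⟩ : ∃ V, V = (Tset A α).filter (fun n => Kint m α n = k) := ⟨_, rfl⟩
    rw [← hV]
    have hVk : ∀ n ∈ V, Kint m α n = k := by
      intro n hn
      rw [hV] at hn
      exact (Finset.mem_filter.mp hn).2
    rcases V.eq_empty_or_nonempty with h0 | hne
    · rw [h0]; simp; positivity
    · have hsub : V ⊆ Tset A α := by rw [hV]; exact Finset.filter_subset _ _
      have := count_bins V (V.min' hne : ℤ) W (2 * G) 2 (by positivity) hW0
        (by
          intro n hn
          have hmin := V.min'_mem hne
          have hle := V.min'_le n hn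
          have t := mem_Tset.mp (hsub hn)
          have t' := mem_Tset.mp (hsub hmin)
          have k1 := hVk _ hn
          have k2 := hVk _ hmin
          have := K_window c _ n α hα t'.1 t'.2.1 t.1 t.2.1 hle (k2.trans k1.symm)
          rw [← hW] at this
          have hle' : ((V.min' hne : ℤ) : ℝ) ≤ n := by exact_mod_cast hle
          constructor <;> linarith) (fun U hU => T_E c α hα hC G hG U (hU.trans hsub))
      exact_mod_cast this
  have hcard : ((Finset.Icc 1 ⌊K⌋).card : ℝ) ≤ K := by
    rw [Int.card_Icc]
    have h0 : 0 ≤ ⌊K⌋ := Int.floor_nonneg.mpr hK0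
    have : (((⌊K⌋ + 1 - 1).toNat : ℤ) : ℝ) = (⌊K⌋ : ℝ) := by
      rw [Int.toNat_of_nonneg (by omega)]; push_cast; ring
    rw [← Int.cast_natCast, this]
    exact Int.floor_le K
  rw [key]
  push_cast
  calc _ ≤ ∑ k ∈ Finset.Icc 1 ⌊K⌋, 2 * (W / (2 * G) + 1) := Finset.sum_le_sum each
    _ = (Finset.Icc 1 ⌊K⌋).card * (2 * (W / (2 * G) + 1)) := by rw [Finset.sum_const, nsmul_eq_mul]
    _ ≤ K * (2 * (W / (2 * G) + 1)) := by gcongr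
    _ = _ := by ring

theorem A_decomp {x h M : ℝ} {A : Finset ℤ} {m : ℤ → ℤ} (c : Ctx x h M A m) (a : ℝ) (ha : 0 < a) :
    (A.card : ℝ) ≤ (721 / 3375 * M / (2 * a) + 1) + ∑ α ∈ Finset.Icc 1 ⌊a⌋, ((Tset A α).card : ℝ) := by
  have hM := c.hM
  obtain ⟨B, hB⟩ : ∃ B, B = A.filter (fun n => ∀ y ∈ A, n < y → 2 * a < (y : ℝ) - n) := ⟨_, rfl⟩
  have hBc : (B.card : ℝ) ≤ 721 / 3375 * M / (2 * a) + 1 := by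
    have := count_bins B M (721 / 3375 * M) (2 * a) 1 (by positivity) (by linarith)
      (by
        intro n hn
        rw [hB] at hn
        have t := (Finset.mem_filter.mp hn).1
        have := c.lo _ t
        have := c.hi _ t
        constructor <;> linarith)
      (by
        intro U hU hc
        obtain ⟨p, hp, q, hq, hpq⟩ := Finset.one_lt_card.mp (by omega : 1 < U.card)
        have hp' := Finset.mem_filter.mp (hB ▸ hU hp)
        have hq' := Finset.mem_filter.mp (hB ▸ hU hq)
        rcases lt_or_gt_of_ne hpq with h | h
        · exact ⟨p, hp, q, hq, (hp'.2 q hq'.1 h).le⟩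
        · exact ⟨q, hq, p, hp, (hq'.2 p hp'.1 h).le⟩)
    simpa using this
  have hsub : A ⊆ B ∪ (Finset.Icc 1 ⌊a⌋).biUnion (fun α => Tset A α) := by
    intro n hn
    rw [Finset.mem_union]
    by_cases hb : ∀ y ∈ A, n < y → 2 * a < (y : ℝ) - n
    · left; rw [hB]; exact Finset.mem_filter.mpr ⟨hn, hb⟩
    · right
      push Not at hb
      obtain ⟨y, hy, hny, hya⟩ := hb
      have hne : (A.filter (fun y => n < y)).Nonempty := ⟨y, Finset.mem_filter.mpr ⟨hy, hny⟩⟩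
      obtain ⟨z, hz⟩ : ∃ z, z = (A.filter (fun y => n < y)).min' hne := ⟨_, rfl⟩
      have hzm := Finset.min'_mem _ hne
      rw [← hz] at hzm
      have hz' := Finset.mem_filter.mp hzm
      have hzle : ∀ y ∈ A, n < y → z ≤ y := by
        intro y hy hny
        rw [hz]
        exact Finset.min'_le _ _ (Finset.mem_filter.mpr ⟨hy, hny⟩)
      obtain ⟨p, hp⟩ := c.odd _ hn
      obtain ⟨r, hr⟩ := c.odd _ hz'.1
      have e : z = n + 2 * (r - p) := by omega
      rw [Finset.mem_biUnion]
      refine ⟨r - p, ?_, ?_⟩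
      · rw [Finset.mem_Icc]
        refine ⟨by omega, Int.le_floor.mpr ?_⟩
        have h1 : (z : ℝ) ≤ y := by exact_mod_cast hzle y hy hny
        have h2 : (z : ℝ) = n + 2 * ((r - p : ℤ) : ℝ) := by exact_mod_cast e
        linarith
      · rw [mem_Tset, ← e]
        exact ⟨hn, hz'.1, hzle⟩
  have h1 := Finset.card_le_card hsub
  have h2 := Finset.card_union_le B ((Finset.Icc 1 ⌊a⌋).biUnion (fun α => Tset A α))
  have h3 : ((Finset.Icc 1 ⌊a⌋).biUnion (fun α => Tset A α)).card ≤ ∑ α ∈ Finset.Icc 1 ⌊a⌋, (Tset A α).card :=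
    Finset.card_biUnion_le
  have h4 : (A.card : ℝ) ≤ B.card + ∑ α ∈ Finset.Icc 1 ⌊a⌋, ((Tset A α).card : ℝ) := by
    exact_mod_cast (h1.trans h2).trans (by omega)
  linarith

theorem sum_split (t : ℤ → ℝ) (am a0 a1 b : ℝ) (ham : 0 ≤ am) (ha0 : 0 ≤ a0) (ha1 : 0 ≤ a1)
    (hb : 0 ≤ b) (h : ∀ α ∈ Finset.Icc 1 ⌊am⌋, t α ≤ a1 + (if (α : ℝ) ≤ a0 then b else 0)) :
    ∑ α ∈ Finset.Icc 1 ⌊am⌋, t α ≤ a1 * am + b * a0 := by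
  have hcard : ∀ K : ℝ, 0 ≤ K → ((Finset.Icc 1 ⌊K⌋).card : ℝ) ≤ K := by
    intro K hK0
    rw [Int.card_Icc]
    have h0 : 0 ≤ ⌊K⌋ := Int.floor_nonneg.mpr hK0
    have : (((⌊K⌋ + 1 - 1).toNat : ℤ) : ℝ) = (⌊K⌋ : ℝ) := by
      rw [Int.toNat_of_nonneg (by omega)]; push_cast; ring
    rw [← Int.cast_natCast, this]
    exact Int.floor_le K
  have h2 : ((Finset.Icc 1 ⌊am⌋).filter (fun α : ℤ => (α : ℝ) ≤ a0)).card ≤ (Finset.Icc 1 ⌊a0⌋).card := by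
    apply Finset.card_le_card
    intro α hα
    rw [Finset.mem_filter, Finset.mem_Icc] at hα
    rw [Finset.mem_Icc]
    exact ⟨hα.1.1, Int.le_floor.mpr hα.2⟩
  have h2' : (((Finset.Icc 1 ⌊am⌋).filter (fun α : ℤ => (α : ℝ) ≤ a0)).card : ℝ) ≤ a0 :=
    le_trans (by exact_mod_cast h2) (hcard a0 ha0)
  refine (Finset.sum_le_sum h).trans ?_
  rw [Finset.sum_add_distrib, ← Finset.sum_filter, Finset.sum_const, Finset.sum_const, nsmul_eq_mul,
    nsmul_eq_mul, mul_comm, mul_comm _ b]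
  have := hcard am ham
  gcongr

theorem tA_par {q v w : ℝ} {A : Finset ℤ} {m : ℤ → ℤ} (hq : 1 ≤ q) (hv : 9 ≤ v)
    (hF : 2 * v ^ 4 ≤ q ^ 3) (hw0 : 0 < w)
    (c : Ctx (q ^ 45) (11 / 6 * v ^ 3 * q ^ 9) (q ^ 9 * w ^ 3) A m) (α : ℤ) (hα : 1 ≤ α)
    (hαm : (α : ℝ) ≤ 0.06 * w ^ 3) (hbig : v * w ^ 3 / q ^ 3 < α) :
    ((Tset A α).card : ℝ) ≤
      2.4781 * (11 / 6 * v ^ 3 * q ^ 9) / w ^ 4 + 0.00212 * q ^ 9 / w ^ 3 := by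
  have hq0 : 0 < q := by linarith
  have hv0 : 0 < v := by linarith
  have hα' : (1:ℝ) ≤ α := by exact_mod_cast hα
  have h1 : (4096 / 3375) ^ 4 * (11 / 6 * v ^ 3 * q ^ 9) * (q ^ 9 * w ^ 3) ^ 3 / (4 * q ^ 45) < (α : ℝ) ^ 3 := by
    calc _ = (4096 / 3375 : ℝ) ^ 4 * (11 / 24) * (v * w ^ 3 / q ^ 3) ^ 3 := by
          field_simp
          norm_num
      _ ≤ 1 * (v * w ^ 3 / q ^ 3) ^ 3 := by gcongr; norm_num
      _ < _ := by rw [one_mul]; gcongr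
  have h2 : (4096 / 3375) ^ 4 * (11 / 6 * v ^ 3 * q ^ 9) * (q ^ 9 * w ^ 3) ^ 2 / (12 * q ^ 45) < 2 * (α : ℝ) ^ 2 := by
    calc _ = (4096 / 3375 : ℝ) ^ 4 * (11 / 72) * (v / q ^ 12) * (v * w ^ 3 / q ^ 3) ^ 2 := by
          field_simp
          norm_num
      _ ≤ (4096 / 3375 : ℝ) ^ 4 * (11 / 72) * 1 * (v * w ^ 3 / q ^ 3) ^ 2 := by
          gcongr
          rw [div_le_one (by positivity)]
          have : q ^ 3 ≤ q ^ 12 := pow_le_pow_right₀ hq (by norm_num)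
          have : v ≤ v ^ 4 := le_self_pow₀ (by linarith) (by norm_num)
          linarith
      _ ≤ 2 * (v * w ^ 3 / q ^ 3) ^ 2 := by gcongr; norm_num
      _ < _ := by gcongr
  have := tA c α hα h1 h2 (0.788 * w ^ 4) (by positivity) (by
    calc 34 * (α : ℝ) * (0.788 * w ^ 4) ^ 3 * q ^ 45 ≤ 34 * (0.06 * w ^ 3) * (0.788 * w ^ 4) ^ 3 * q ^ 45 := by gcongr
      _ = (34 * 0.06 * 0.788 ^ 3) * (q ^ 9 * w ^ 3) ^ 5 := by ring
      _ ≤ 1 * (q ^ 9 * w ^ 3) ^ 5 := by gcongr; norm_num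
      _ = _ := one_mul _)
  refine this.trans ?_
  have e : 2 * ((4096 / 3375) ^ 6 * (11 / 6 * v ^ 3 * q ^ 9) * (q ^ 9 * w ^ 3) ^ 4 / (8 * (α : ℝ) ^ 3 * q ^ 45) / (2 * (0.788 * w ^ 4)) + 1)
      * (11 / 9 * (4 * (α : ℝ) ^ 3 * q ^ 45 / (q ^ 9 * w ^ 3) ^ 4)) =
      ((4096 / 3375) ^ 6 * 44 / 72 / 0.788) * (11 / 6 * v ^ 3 * q ^ 9) / w ^ 4 + 88 / 9 * (α : ℝ) ^ 3 * q ^ 9 / w ^ 12 := by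
    field_simp
    ring
  rw [e]
  have e2 : 88 / 9 * (α : ℝ) ^ 3 * q ^ 9 / w ^ 12 ≤ 0.00212 * q ^ 9 / w ^ 3 := by
    calc 88 / 9 * (α : ℝ) ^ 3 * q ^ 9 / w ^ 12 ≤ 88 / 9 * (0.06 * w ^ 3) ^ 3 * q ^ 9 / w ^ 12 := by gcongr
      _ = (88 / 9 * 0.06 ^ 3) * q ^ 9 / w ^ 3 := by field_simp
      _ ≤ _ := by gcongr; norm_num
  have e3 : ((4096 / 3375) ^ 6 * 44 / 72 / 0.788) * (11 / 6 * v ^ 3 * q ^ 9) / w ^ 4 ≤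
      2.4781 * (11 / 6 * v ^ 3 * q ^ 9) / w ^ 4 := by
    gcongr
    norm_num
  linarith

theorem tB1_par {q v w : ℝ} {A : Finset ℤ} {m : ℤ → ℤ} (hq : 1 ≤ q) (hv : 9 ≤ v)
    (hF : 2 * v ^ 4 ≤ q ^ 3) (hw0 : 0 < w)
    (c : Ctx (q ^ 45) (11 / 6 * v ^ 3 * q ^ 9) (q ^ 9 * w ^ 3) A m) (α : ℤ) (hα : 1 ≤ α)
    (hα0 : (α : ℝ) ≤ v * w ^ 3 / q ^ 3) (hB1 : w ^ 3 ≤ 2.5 * v ^ 2 * q ^ 3) :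
    ((Tset A α).card : ℝ) ≤ q ^ 12 / (v * w ^ 3) + 2 := by
  have hq0 : 0 < q := by linarith
  have hv0 : 0 < v := by linarith
  have hα' : (1:ℝ) ≤ α := by exact_mod_cast hα
  have hF2 : 4 * v ^ 8 ≤ q ^ 6 := by
    calc 4 * v ^ 8 = (2 * v ^ 4) ^ 2 := by ring
      _ ≤ (q ^ 3) ^ 2 := by gcongr
      _ = _ := by ring
  have hw6 : w ^ 6 ≤ 6.25 * v ^ 4 * q ^ 6 := by
    calc w ^ 6 = (w ^ 3) ^ 2 := by ring
      _ ≤ (2.5 * v ^ 2 * q ^ 3) ^ 2 := by gcongr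
      _ = _ := by ring
  have h2 : (4096 / 3375) ^ 4 * (11 / 6 * v ^ 3 * q ^ 9) * (q ^ 9 * w ^ 3) ^ 2 / (12 * q ^ 45) < 2 * (α : ℝ) ^ 2 := by
    calc _ = (4096 / 3375 : ℝ) ^ 4 * (11 / 72) * v ^ 3 * w ^ 6 / q ^ 18 := by
          field_simp
          norm_num
      _ ≤ (4096 / 3375 : ℝ) ^ 4 * (11 / 72) * v ^ 3 * (6.25 * v ^ 4 * q ^ 6) / q ^ 18 := by
          gcongr
      _ = ((4096 / 3375 : ℝ) ^ 4 * (11 / 72) * 6.25) * (v ^ 7 / q ^ 12) := by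
          field_simp
      _ ≤ ((4096 / 3375 : ℝ) ^ 4 * (11 / 72) * 6.25) * (1 / 4) := by
          refine mul_le_mul_of_nonneg_left ?_ (by norm_num)
          rw [div_le_div_iff₀ (by positivity) (by norm_num)]
          have : q ^ 6 ≤ q ^ 12 := pow_le_pow_right₀ hq (by norm_num)
          have : v ^ 7 ≤ v ^ 8 := pow_le_pow_right₀ (by linarith) (by norm_num)
          linarith
      _ < 2 * 1 := by norm_num
      _ ≤ _ := by gcongr; exact one_le_pow₀ hα'
  have := tB1 c α hα h2 (721 / 3375 * v * w ^ 6 / q ^ 3) (by positivity) (by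
    calc 34 * (α : ℝ) * (721 / 3375 * v * w ^ 6 / q ^ 3) ^ 3 * q ^ 45
        ≤ 34 * (v * w ^ 3 / q ^ 3) * (721 / 3375 * v * w ^ 6 / q ^ 3) ^ 3 * q ^ 45 := by gcongr
      _ = (34 * (721 / 3375) ^ 3 * v ^ 4 * w ^ 6) * q ^ 33 * w ^ 15 := by field_simp
      _ ≤ (34 * (721 / 3375) ^ 3 * v ^ 4 * (6.25 * v ^ 4 * q ^ 6)) * q ^ 33 * w ^ 15 := by gcongr
      _ = (34 * (721 / 3375) ^ 3 * 6.25 / 4) * (4 * v ^ 8) * (q ^ 39 * w ^ 15) := by ring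
      _ ≤ 1 * q ^ 6 * (q ^ 39 * w ^ 15) := by gcongr; norm_num
      _ = (q ^ 9 * w ^ 3) ^ 5 := by ring)
  refine this.trans (le_of_eq ?_)
  field_simp

theorem tB2_par {q v w : ℝ} {A : Finset ℤ} {m : ℤ → ℤ} (hq : 1 ≤ q) (hv : 9 ≤ v)
    (hw0 : 0 < w)
    (c : Ctx (q ^ 45) (11 / 6 * v ^ 3 * q ^ 9) (q ^ 9 * w ^ 3) A m) (α : ℤ) (hα : 1 ≤ α)
    (hα0 : (α : ℝ) ≤ v * w ^ 3 / q ^ 3) :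
    ((Tset A α).card : ℝ) ≤ (1 + 0.3315 * v ^ 3 * w ^ 6 / q ^ 18) * (2.617 * v * q ^ 15 / w ^ 6 + 1) := by
  have hq0 : 0 < q := by linarith
  have hv0 : 0 < v := by linarith
  have hα' : (1:ℝ) ≤ α := by exact_mod_cast hα
  obtain ⟨C, hC⟩ : ∃ C, C = (4096 / 3375) ^ 4 * (11 / 6 * v ^ 3 * q ^ 9) * (q ^ 9 * w ^ 3) ^ 2 / (12 * q ^ 45) := ⟨_, rfl⟩
  have h2 : C ≤ 0.3315 * v ^ 3 * w ^ 6 / q ^ 18 := by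
    calc C = ((4096 / 3375 : ℝ) ^ 4 * (11 / 72)) * v ^ 3 * w ^ 6 / q ^ 18 := by
          rw [hC]
          field_simp
          norm_num
      _ ≤ _ := by gcongr; norm_num
  have hC0 : 0 ≤ C := by rw [hC]; positivity
  have := tB2 c α hα (⌊C⌋₊ + 1) (by omega) (by rw [← hC]; push_cast; exact Nat.lt_floor_add_one C)
  refine this.trans ?_
  have hs : ((⌊C⌋₊ + 1 : ℕ) : ℝ) ≤ 1 + 0.3315 * v ^ 3 * w ^ 6 / q ^ 18 := by
    push_cast
    linarith [Nat.floor_le hC0]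
  have h3 : 721 / 3375 * (q ^ 9 * w ^ 3) / (2 * ((q ^ 9 * w ^ 3) ^ 4 / (24.5 * q ^ 45) / α)) ≤ 2.617 * v * q ^ 15 / w ^ 6 := by
    calc _ = (721 / 3375 * 24.5 / 2) * α * (q ^ 18 / w ^ 9) := by field_simp
      _ ≤ 2.617 * (v * w ^ 3 / q ^ 3) * (q ^ 18 / w ^ 9) := by gcongr; norm_num
      _ = _ := by field_simp
  gcongr

theorem interval_bound {q v w : ℝ} {A : Finset ℤ} {m : ℤ → ℤ} (hq : 1 ≤ q) (hv : 9 ≤ v)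
    (hF : 2 * v ^ 4 ≤ q ^ 3) (hw0 : 0 < w) (hwq : w ≤ q ^ 3)
    (c : Ctx (q ^ 45) (11 / 6 * v ^ 3 * q ^ 9) (q ^ 9 * w ^ 3) A m) :
    (A.card : ℝ) ≤ 3.01 * q ^ 9 + 0.15 * (11 / 6 * v ^ 3 * q ^ 9) / w := by
  have hq0 : 0 < q := by linarith
  have hv0 : 0 < v := by linarith
  have hF2 : 4 * v ^ 8 ≤ q ^ 6 := by
    calc 4 * v ^ 8 = (2 * v ^ 4) ^ 2 := by ring
      _ ≤ (q ^ 3) ^ 2 := by gcongr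
      _ = _ := by ring
  have hv4 : (6561 : ℝ) ≤ v ^ 4 := by
    calc (6561 : ℝ) = 9 ^ 4 := by norm_num
      _ ≤ _ := by gcongr
  have hv3 : (729 : ℝ) ≤ v ^ 3 := by
    calc (729 : ℝ) = 9 ^ 3 := by norm_num
      _ ≤ _ := by gcongr
  have hq39 : q ^ 3 ≤ q ^ 9 := pow_le_pow_right₀ hq (by norm_num)
  have hq36 : q ^ 3 ≤ q ^ 6 := pow_le_pow_right₀ hq (by norm_num)
  have hdec := A_decomp c (0.06 * w ^ 3) (by positivity)
  have e0 : 721 / 3375 * (q ^ 9 * w ^ 3) / (2 * (0.06 * w ^ 3)) ≤ 1.7804 * q ^ 9 := by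
    calc _ = (721 / 3375 / 0.12) * q ^ 9 := by field_simp; norm_num
      _ ≤ _ := by gcongr; norm_num
  obtain ⟨a1, ha1⟩ : ∃ a, a = 2.4781 * (11 / 6 * v ^ 3 * q ^ 9) / w ^ 4 + 0.00212 * q ^ 9 / w ^ 3 := ⟨_, rfl⟩
  obtain ⟨a0, ha0⟩ : ∃ a, a = v * w ^ 3 / q ^ 3 := ⟨_, rfl⟩
  have ha10 : 0 ≤ a1 := by rw [ha1]; positivity
  have ha00 : 0 ≤ a0 := by rw [ha0]; positivity
  have gen : ∀ b : ℝ, 0 ≤ b → (∀ α : ℤ, 1 ≤ α → (α : ℝ) ≤ a0 → ((Tset A α).card : ℝ) ≤ b) →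
      (A.card : ℝ) ≤ 1.7804 * q ^ 9 + 1 + (a1 * (0.06 * w ^ 3) + b * a0) := by
    intro b hb hB
    have := sum_split (fun α => ((Tset A α).card : ℝ)) (0.06 * w ^ 3) a0 a1 b (by positivity) ha00 ha10 hb (by
      intro α hα
      rw [Finset.mem_Icc] at hα
      have hαm : (α : ℝ) ≤ 0.06 * w ^ 3 := Int.le_floor.mp hα.2
      split_ifs with hi
      · have := hB α hα.1 hi
        linarith
      · push Not at hi
        have := tA_par hq hv hF hw0 c α hα.1 hαm (by rw [← ha0]; exact hi)
        rw [← ha1] at this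
        simpa using this)
    linarith
  have ea : a1 * (0.06 * w ^ 3) ≤ 0.15 * (11 / 6 * v ^ 3 * q ^ 9) / w + 0.001 * q ^ 9 := by
    calc a1 * (0.06 * w ^ 3) = (2.4781 * 0.06) * (11 / 6 * v ^ 3 * q ^ 9) / w + (0.00212 * 0.06) * q ^ 9 := by
          rw [ha1]; field_simp
      _ ≤ _ := by gcongr <;> norm_num
  rcases le_or_gt (w ^ 3) (2.5 * v ^ 2 * q ^ 3) with hB | hB
  · have := gen (q ^ 12 / (v * w ^ 3) + 2) (by positivity) (by
      intro α hα hα0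
      exact tB1_par hq hv hF hw0 c α hα (by rw [← ha0]; exact hα0) hB)
    have e1 : (q ^ 12 / (v * w ^ 3) + 2) * a0 = q ^ 9 + 2 * a0 := by
      rw [ha0]; field_simp
    have e2 : a0 ≤ 2.5 * v ^ 3 := by
      rw [ha0, div_le_iff₀ (by positivity)]
      calc v * w ^ 3 ≤ v * (2.5 * v ^ 2 * q ^ 3) := by gcongr
        _ = _ := by ring
    have e3 : q ^ 3 * q ^ 6 = q ^ 9 := by ring
    have e4 : v ^ 3 ≤ v ^ 4 := pow_le_pow_right₀ (by linarith) (by norm_num)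
    have e5 : 10000 * q ^ 3 ≤ q ^ 9 := by nlinarith
    linarith
  · have hs : 0 ≤ 0.3315 * v ^ 3 * w ^ 6 / q ^ 18 := by positivity
    have := gen ((1 + 0.3315 * v ^ 3 * w ^ 6 / q ^ 18) * (2.617 * v * q ^ 15 / w ^ 6 + 1)) (by positivity) (by
      intro α hα hα0
      exact tB2_par hq hv hw0 c α hα (by rw [← ha0]; exact hα0))
    have e1 : ((1 + 0.3315 * v ^ 3 * w ^ 6 / q ^ 18) * (2.617 * v * q ^ 15 / w ^ 6 + 1)) * a0
      = 2.617 * v ^ 2 * q ^ 12 / w ^ 3 + (0.3315 * 2.617) * v ^ 5 * w ^ 3 / q ^ 6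
        + (v + 0.3315 * v ^ 4 * (w ^ 6 / q ^ 18)) * (w ^ 3 / q ^ 3) := by
      rw [ha0]; field_simp
    have f1 : 2.617 * v ^ 2 * q ^ 12 / w ^ 3 ≤ 1.0468 * q ^ 9 := by
      rw [div_le_iff₀ (by positivity)]
      calc 2.617 * v ^ 2 * q ^ 12 = 1.0468 * q ^ 9 * (2.5 * v ^ 2 * q ^ 3) := by ring
        _ ≤ _ := by gcongr
    have w3 : w ^ 3 ≤ q ^ 9 := by
      calc w ^ 3 ≤ (q ^ 3) ^ 3 := by gcongr
        _ = _ := by ring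
    have w6 : w ^ 6 / q ^ 18 ≤ 1 := by
      rw [div_le_one (by positivity)]
      calc w ^ 6 ≤ (q ^ 3) ^ 6 := by gcongr
        _ = _ := by ring
    have w33 : w ^ 3 / q ^ 3 ≤ q ^ 6 := by
      rw [div_le_iff₀ (by positivity)]
      linarith
    have f2 : (0.3315 * 2.617) * v ^ 5 * w ^ 3 / q ^ 6 ≤ 0.001 * q ^ 9 := by
      rw [div_le_iff₀ (by positivity)]
      have : 729 * v ^ 5 ≤ v ^ 8 := by
        calc 729 * v ^ 5 ≤ v ^ 3 * v ^ 5 := by gcongr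
          _ = _ := by ring
      calc (0.3315 * 2.617) * v ^ 5 * w ^ 3 ≤ (0.3315 * 2.617) * (q ^ 6 / 2916) * q ^ 9 := by
            gcongr
            linarith
        _ = (0.3315 * 2.617 / 2916) * (q ^ 9 * q ^ 6) := by ring
        _ ≤ 0.001 * (q ^ 9 * q ^ 6) := by gcongr; norm_num
        _ = _ := by ring
    have f3 : (v + 0.3315 * v ^ 4 * (w ^ 6 / q ^ 18)) * (w ^ 3 / q ^ 3) ≤ 0.168 * q ^ 9 := by
      have g1 : 729 * v ≤ v ^ 4 := by
        calc 729 * v ≤ v ^ 3 * v := by gcongr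
          _ = _ := by ring
      calc (v + 0.3315 * v ^ 4 * (w ^ 6 / q ^ 18)) * (w ^ 3 / q ^ 3)
          ≤ (v ^ 4 / 729 + 0.3315 * v ^ 4 * 1) * q ^ 6 := by
            gcongr
            linarith
        _ ≤ (0.168 * q ^ 3) * q ^ 6 := by
            gcongr
            linarith
        _ = _ := by ring
    linarith

theorem F_fact (L : ℝ) (hL : 150 ≤ L) : 8 * (6 * L) ^ 4 ≤ Real.exp (L / 5) := by
  have h1 : L / 150 ≤ Real.exp ((L - 150) / 150) := by
    have := Real.add_one_le_exp ((L - 150) / 150)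
    linarith
  have h2 : (L / 150) ^ 4 ≤ Real.exp ((L - 150) / 5) := by
    calc (L / 150) ^ 4 ≤ (Real.exp ((L - 150) / 150)) ^ 4 := by gcongr
      _ = Real.exp (4 * ((L - 150) / 150)) := by rw [← Real.exp_nat_mul]; norm_num
      _ ≤ _ := Real.exp_le_exp.mpr (by linarith)
  have h3 : (2.7 : ℝ) ^ 30 ≤ Real.exp 30 := by
    have := Real.exp_one_gt_d9
    calc (2.7 : ℝ) ^ 30 ≤ (Real.exp 1) ^ 30 := by gcongr; linarith
      _ = Real.exp 30 := by rw [← Real.exp_nat_mul]; norm_num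
  have h4 : (8 * 1296 * 150 ^ 4 : ℝ) ≤ 2.7 ^ 30 := by norm_num
  calc 8 * (6 * L) ^ 4 = (8 * 1296 * 150 ^ 4) * (L / 150) ^ 4 := by ring
    _ ≤ Real.exp 30 * Real.exp ((L - 150) / 5) := by
        gcongr
        linarith
    _ = _ := by rw [← Real.exp_add]; congr 1; ring

theorem geo_sum (J : ℕ) : ∑ j ∈ Finset.range J, (15 / 16 : ℝ) ^ j ≤ 16 := by
  have : ∑ j ∈ Finset.range J, (15 / 16 : ℝ) ^ j = 16 * (1 - (15 / 16) ^ J) := by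
    induction J with
    | zero => simp
    | succ k ih => rw [Finset.sum_range_succ, ih, pow_succ]; ring
  rw [this]
  have : (0:ℝ) ≤ (15 / 16) ^ J := by positivity
  linarith

theorem exists_cube (y : ℝ) (hy : 0 < y) : ∃ v : ℝ, 0 < v ∧ v ^ 3 = y := by
  refine ⟨y ^ ((1 : ℝ) / 3), by positivity, ?_⟩
  rw [← Real.rpow_natCast, ← Real.rpow_mul hy.le]
  norm_num

theorem Sset_fin (x h M N : ℝ) (hM : 0 < M) : (Sset x h M N).Finite := by
  apply (Set.finite_Icc (0 : ℤ) ⌊N⌋).subset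
  intro u hu
  obtain ⟨_, h1, h2, _⟩ := hu
  refine ⟨?_, Int.le_floor.mpr h2⟩
  have : (0 : ℝ) < u := by linarith
  exact_mod_cast this.le

theorem main_par (q v w L : ℝ) (J : ℕ) (hq : 1 ≤ q) (hL : 150 ≤ L) (hv0 : 0 < v) (hvL : v ^ 3 = 6 * L)
    (hF : 2 * v ^ 4 ≤ q ^ 3) (hw0 : 0 < w) (hwL : w ^ 3 = 60.5 * L)
    (hJ : q ^ 3 ≤ (16 / 15) ^ J) (hJ2 : (J : ℝ) ≤ 16 * L / 15 + 1) :
    ((Sset (q ^ 45) (11 * q ^ 9 * L) (5.5 * (11 * q ^ 9 * L)) (q ^ 18)).ncard : ℝ) <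
      0.4372 * (11 * q ^ 9 * L) := by
  have hq0 : 0 < q := by linarith
  have hq9 : 1 ≤ q ^ 9 := one_le_pow₀ hq
  have hv : 9 ≤ v := by
    refine le_of_pow_le_pow_left₀ (n := 3) (by norm_num) hv0.le ?_
    rw [hvL]; linarith
  have hw : 20 ≤ w := by
    refine le_of_pow_le_pow_left₀ (n := 3) (by norm_num) hw0.le ?_
    rw [hwL]; linarith
  have hhe : 11 * q ^ 9 * L = 11 / 6 * v ^ 3 * q ^ 9 := by rw [hvL]; ring
  have hHe : 5.5 * (11 * q ^ 9 * L) = q ^ 9 * w ^ 3 := by rw [hwL]; ring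
  obtain ⟨h, hh⟩ : ∃ h, h = 11 * q ^ 9 * L := ⟨_, rfl⟩
  have hh0 : 0 < h := by rw [hh]; positivity
  rw [← hh] at hhe hHe
  rw [← hh, hHe]
  have hfin := Sset_fin (q ^ 45) h (q ^ 9 * w ^ 3) (q ^ 18) (by positivity)
  rw [Set.ncard_eq_toFinset_card _ hfin]
  obtain ⟨S, hS⟩ : ∃ S, S = hfin.toFinset := ⟨_, rfl⟩
  rw [← hS]
  have hmem : ∀ u ∈ S, Odd u ∧ q ^ 9 * w ^ 3 < (u : ℝ) ∧ (u : ℝ) ≤ q ^ 18 ∧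
    1 - h / (u : ℝ) ^ 2 ≤ Int.fract (q ^ 45 / (u : ℝ) ^ 2) := by
    intro u hu
    rw [hS, Set.Finite.mem_toFinset] at hu
    obtain ⟨h1, h2, h3, h4, _⟩ := hu
    exact ⟨h1, h2, h3, h4⟩
  have each : ∀ j ∈ Finset.range J, ((S.filter (fun u : ℤ => q ^ 9 * (w * (16 / 15) ^ j) ^ 3 < (u : ℝ) ∧
      (u : ℝ) ≤ 4096 / 3375 * (q ^ 9 * (w * (16 / 15) ^ j) ^ 3))).card : ℝ) ≤
      3.01 * q ^ 9 + 0.15 * h / w * (15 / 16) ^ j := by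
    intro j _
    obtain ⟨A, hA⟩ : ∃ A, A = S.filter (fun u : ℤ => q ^ 9 * (w * (16 / 15) ^ j) ^ 3 < (u : ℝ) ∧
      (u : ℝ) ≤ 4096 / 3375 * (q ^ 9 * (w * (16 / 15) ^ j) ^ 3)) := ⟨_, rfl⟩
    rw [← hA]
    have hmA : ∀ u ∈ A, u ∈ S ∧ q ^ 9 * (w * (16 / 15) ^ j) ^ 3 < (u : ℝ) ∧
      (u : ℝ) ≤ 4096 / 3375 * (q ^ 9 * (w * (16 / 15) ^ j) ^ 3) := by
      intro u hu
      rw [hA] at hu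
      exact Finset.mem_filter.mp hu
    rcases A.eq_empty_or_nonempty with h0 | ⟨u, hu⟩
    · rw [h0, Finset.card_empty, Nat.cast_zero]; positivity
    · have hρ : (1 : ℝ) ≤ (16 / 15) ^ j := one_le_pow₀ (by norm_num)
      have hwj : w ≤ w * (16 / 15) ^ j := le_mul_of_one_le_right hw0.le hρ
      obtain ⟨z, hz⟩ : ∃ z, z = w * (16 / 15 : ℝ) ^ j := ⟨_, rfl⟩
      have hze : 0.15 * h / w * (15 / 16) ^ j = 0.15 * h / z := by
        rw [hz]
        have : (15 / 16 : ℝ) ^ j = 1 / (16 / 15) ^ j := by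
          rw [one_div, ← inv_pow]; norm_num
        rw [this]
        field_simp
      rw [hze, hhe]
      rw [← hz] at hmA hwj
      have hz3 : w ^ 3 ≤ z ^ 3 := by gcongr
      have hz0 : 0 < z := by linarith
      obtain ⟨a1, a2, a3⟩ := hmA u hu
      have hzq : z ≤ q ^ 3 := by
        refine le_of_pow_le_pow_left₀ (n := 3) (by norm_num) (by positivity) ?_
        have a4 := (hmem u a1).2.2.1
        have a5 : q ^ 9 * z ^ 3 ≤ q ^ 9 * (q ^ 3) ^ 3 := by
          calc q ^ 9 * z ^ 3 ≤ q ^ 18 := by linarith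
            _ = _ := by ring
        exact le_of_mul_le_mul_left a5 (by positivity)
      refine interval_bound (m := fun u => ⌊q ^ 45 / (u : ℝ) ^ 2⌋ + 1) hq hv hF hz0 hzq ?_
      refine ⟨by positivity, by positivity, ?_, ?_, ?_, ?_, ?_, ?_, ?_⟩
      · nlinarith
      · have : q ^ 9 * w ^ 3 ≤ q ^ 9 * z ^ 3 := by gcongr
        linarith
      · intro u hu
        exact (hmem u (hmA u hu).1).1
      · intro u hu
        exact (hmA u hu).2.1
      · intro u hu
        exact (hmA u hu).2.2
      · intro u hu
        push_cast
        linarith [Int.lt_floor_add_one (q ^ 45 / (u : ℝ) ^ 2)]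
      · intro u hu
        have := (hmem u (hmA u hu).1).2.2.2
        rw [Int.fract, hhe] at this
        push_cast
        linarith
  have hcover : S ⊆ (Finset.range J).biUnion (fun j => S.filter (fun u : ℤ => q ^ 9 * (w * (16 / 15) ^ j) ^ 3 < (u : ℝ) ∧
      (u : ℝ) ≤ 4096 / 3375 * (q ^ 9 * (w * (16 / 15) ^ j) ^ 3))) := by
    intro u hu
    obtain ⟨_, a2, a3, _⟩ := hmem u hu
    have hPJ : (u : ℝ) ≤ q ^ 9 * (w * (16 / 15) ^ J) ^ 3 := by
      refine a3.trans ?_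
      calc q ^ 18 = q ^ 9 * (1 * q ^ 3) ^ 3 := by ring
        _ ≤ _ := by gcongr; linarith
    classical
    have hex : ∃ k : ℕ, (u : ℝ) ≤ q ^ 9 * (w * (16 / 15) ^ k) ^ 3 := ⟨J, hPJ⟩
    obtain ⟨k, hk⟩ : ∃ k, k = Nat.find hex := ⟨_, rfl⟩
    have k1 : (u : ℝ) ≤ q ^ 9 * (w * (16 / 15) ^ k) ^ 3 := by rw [hk]; exact Nat.find_spec hex
    have k2 : k ≤ J := by rw [hk]; exact Nat.find_min' hex hPJ
    have k3 : k ≠ 0 := by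
      intro h0
      rw [h0] at k1
      simp only [pow_zero, mul_one] at k1
      linarith
    obtain ⟨j, rfl⟩ := Nat.exists_eq_succ_of_ne_zero k3
    have k4 : q ^ 9 * (w * (16 / 15) ^ j) ^ 3 < (u : ℝ) := by
      have := Nat.find_min hex (m := j) (by omega)
      push Not at this
      exact this
    rw [Finset.mem_biUnion]
    refine ⟨j, Finset.mem_range.mpr (by omega), Finset.mem_filter.mpr ⟨hu, k4, k1.trans (le_of_eq ?_)⟩⟩
    rw [Nat.succ_eq_add_one, pow_succ]
    ring
  have hc1 := (Finset.card_le_card hcover).trans Finset.card_biUnion_le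
  have hc2 : (S.card : ℝ) ≤ ∑ j ∈ Finset.range J, (3.01 * q ^ 9 + 0.15 * h / w * (15 / 16) ^ j) := by
    refine le_trans ?_ (Finset.sum_le_sum each)
    exact_mod_cast hc1
  rw [Finset.sum_add_distrib, Finset.sum_const, Finset.card_range, nsmul_eq_mul, ← Finset.mul_sum] at hc2
  have g1 : 0.15 * h / w * ∑ j ∈ Finset.range J, (15 / 16 : ℝ) ^ j ≤ 0.15 * h / 20 * 16 := by
    have := geo_sum J
    gcongr
  have g2 : (J : ℝ) * (3.01 * q ^ 9) ≤ (1.0734 * L) * (3.01 * q ^ 9) := by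
    gcongr
    linarith
  have g3 : 0 < q ^ 9 * L := by positivity
  have g4 : h = 11 * (q ^ 9 * L) := by rw [hh]; ring
  linarith

theorem card_Sset_medium (x : ℝ) (hx : Real.exp 150 ≤ x)
    (hH : 5.5 * (11 * x ^ ((1 : ℝ) / 5) * Real.log x) ≤ 5 * x ^ ((1 : ℝ) / 4)) :
    ((Sset x (11 * x ^ ((1 : ℝ) / 5) * Real.log x)
        (5.5 * (11 * x ^ ((1 : ℝ) / 5) * Real.log x)) (x ^ ((2 : ℝ) / 5))).ncard : ℝ) <
      0.4372 * (11 * x ^ ((1 : ℝ) / 5) * Real.log x) := by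
  have hx0 : 0 < x := (Real.exp_pos _).trans_le hx
  obtain ⟨L, hLx⟩ : ∃ L, L = Real.log x := ⟨_, rfl⟩
  have hL : 150 ≤ L := by rw [hLx]; exact (Real.le_log_iff_exp_le hx0).mpr hx
  have hqpow : ∀ n : ℕ, Real.exp (L / 45) ^ n = Real.exp (n * (L / 45)) := fun n =>
    (Real.exp_nat_mul _ _).symm
  have e45 : x = Real.exp (L / 45) ^ 45 := by
    rw [hqpow]
    have : ((45 : ℕ) : ℝ) * (L / 45) = L := by push_cast; ring
    rw [this, hLx, Real.exp_log hx0]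
  have e9 : x ^ ((1 : ℝ) / 5) = Real.exp (L / 45) ^ 9 := by
    rw [Real.rpow_def_of_pos hx0, hqpow, ← hLx]
    congr 1; push_cast; ring
  have e18 : x ^ ((2 : ℝ) / 5) = Real.exp (L / 45) ^ 18 := by
    rw [Real.rpow_def_of_pos hx0, hqpow, ← hLx]
    congr 1; push_cast; ring
  rw [e9, e18, ← hLx, e45]
  obtain ⟨v, hv0, hv⟩ := exists_cube (6 * L) (by positivity)
  obtain ⟨w, hw0, hw⟩ := exists_cube (60.5 * L) (by positivity)
  refine main_par (Real.exp (L / 45)) v w L ⌈16 * L / 15⌉₊ ?_ hL hv0 hv ?_ hw0 hw ?_ ?_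
  · exact Real.one_le_exp (by positivity)
  · refine le_of_pow_le_pow_left₀ (n := 3) (by norm_num) (by positivity) ?_
    calc (2 * v ^ 4) ^ 3 = 8 * (v ^ 3) ^ 4 := by ring
      _ ≤ Real.exp (L / 5) := by rw [hv]; exact F_fact L hL
      _ = Real.exp (L / 45) ^ 9 := by
        rw [hqpow]; congr 1; push_cast; ring
      _ = _ := by ring
  · rw [hqpow]
    have h1 : (1 : ℝ) / 16 ≤ Real.log (16 / 15) := by
      have := Real.one_sub_inv_le_log_of_pos (x := 16 / 15) (by norm_num)
      norm_num at this ⊢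
      linarith
    have h2 : Real.exp (1 / 16) ≤ 16 / 15 := (Real.le_log_iff_exp_le (by norm_num)).mp h1
    calc Real.exp (((3 : ℕ) : ℝ) * (L / 45)) ≤ Real.exp ((⌈16 * L / 15⌉₊ : ℝ) * (1 / 16)) := by
          apply Real.exp_le_exp.mpr
          have := Nat.le_ceil (16 * L / 15)
          push_cast
          linarith
      _ = Real.exp (1 / 16) ^ ⌈16 * L / 15⌉₊ := Real.exp_nat_mul _ _
      _ ≤ _ := by gcongr
  · exact (Nat.ceil_lt_add_one (by positivity)).le
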